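/- Multivariate Taylor's theorem with integral remainder: Let B be a closed ball in R^n centered at a point a, and let f : R^n -> R be (k+1) times continuously differentiable on B. Then for every x in B, f(x) = sum over multi-indices alpha with |alpha| <= k of (D^alpha f(a) / alpha!) * (x - a)^alpha + sum over multi-indices beta with |beta| = k+1 of R_beta(x) * (x - a)^beta, where R_beta(x) = (|beta| / beta!) * integral from 0 to 1 of (1 - t)^(|beta| - 1) * D^beta f(a + t*(x - a)) dt. -/

import Mathlib

open Finset

/-- Partial derivative of `g : ℝⁿ → ℝ` in the `j`-th coordinate direction. -/
noncomputable def pder {n : ℕ} (j : Fin n) (g : (Fin n → ℝ) → ℝ) : (Fin n → ℝ) → ℝ :=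
  fun x => deriv (fun t : ℝ => g (Function.update x j t)) (x j)

/-- Iterated partial derivative `D^α g` for a multi-index `α : Fin n → ℕ`:
`α j`-fold differentiation in the `j`-th coordinate, for each `j`. -/
noncomputable def mder {n : ℕ} (α : Fin n → ℕ) (g : (Fin n → ℝ) → ℝ) : (Fin n → ℝ) → ℝ :=
  (List.finRange n).foldr (fun j h => (pder j)^[α j] h) g

/-- Multi-index factorial `α! = α₁! ⋯ αₙ!`. -/
def mfact {n : ℕ} (α : Fin n → ℕ) : ℕ := ∏ j, Nat.factorial (α j)

/-- Multi-index power `x^α = x₁^{α₁} ⋯ xₙ^{αₙ}`. -/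
def mpow {n : ℕ} (x : Fin n → ℝ) (α : Fin n → ℕ) : ℝ := ∏ j, x j ^ α j

/-- The finite set of multi-indices `α` with `|α| ≤ k`. -/
def mIdxLe (n k : ℕ) : Finset (Fin n → ℕ) :=
  (Fintype.piFinset fun _ => Finset.range (k + 1)).filter fun α => ∑ j, α j ≤ k

/-- The finite set of multi-indices `α` with `|α| = k`. -/
def mIdxEq (n k : ℕ) : Finset (Fin n → ℕ) :=
  (Fintype.piFinset fun _ => Finset.range (k + 1)).filter fun α => ∑ j, α j = k

theorem mem_mIdxEq {n k : ℕ} {α : Fin n → ℕ} : α ∈ mIdxEq n k ↔ ∑ j, α j = k := by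
  simp only [mIdxEq, mem_filter, Fintype.mem_piFinset, mem_range, and_iff_right_iff_imp]
  intro h j
  have := single_le_sum (f := α) (fun _ _ => Nat.zero_le _) (mem_univ j)
  omega

theorem mem_mIdxLe {n k : ℕ} {α : Fin n → ℕ} : α ∈ mIdxLe n k ↔ ∑ j, α j ≤ k := by
  simp only [mIdxLe, mem_filter, Fintype.mem_piFinset, mem_range, and_iff_right_iff_imp]
  intro h j
  have := single_le_sum (f := α) (fun _ _ => Nat.zero_le _) (mem_univ j)
  omega

theorem sum_mIdxLe {n k : ℕ} (φ : (Fin n → ℕ) → ℝ) :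
    ∑ α ∈ mIdxLe n k, φ α = ∑ m ∈ range (k + 1), ∑ α ∈ mIdxEq n m, φ α := by
  rw [← sum_fiberwise_of_maps_to (s := mIdxLe n k) (t := range (k + 1)) (g := fun α => ∑ j, α j)
    (fun α hα => by simpa [Nat.lt_succ_iff] using mem_mIdxLe.1 hα)]
  refine sum_congr rfl fun m hm => sum_congr ?_ fun _ _ => rfl
  ext α
  simp only [mem_filter, mem_mIdxLe, mem_mIdxEq, mem_range] at hm ⊢
  omega

theorem mfact_add_single {n : ℕ} (α : Fin n → ℕ) (j : Fin n) :
    mfact (α + Pi.single j 1) = (α j + 1) * mfact α := by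
  simp only [mfact]
  rw [← mul_prod_erase univ _ (mem_univ j), ← mul_prod_erase univ (fun i => (α i).factorial)
    (mem_univ j), ← mul_assoc]
  congr 1
  · simp [Nat.factorial_succ]
  · refine prod_congr rfl fun i hi => ?_
    simp [Pi.single_eq_of_ne (ne_of_mem_erase hi)]

theorem mpow_add_single {n : ℕ} (v : Fin n → ℝ) (α : Fin n → ℕ) (j : Fin n) :
    mpow v (α + Pi.single j 1) = v j * mpow v α := by
  simp only [mpow]
  rw [← mul_prod_erase univ _ (mem_univ j), ← mul_prod_erase univ (fun i => v i ^ α i)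
    (mem_univ j), ← mul_assoc]
  congr 1
  · simp [pow_succ']
  · refine prod_congr rfl fun i hi => ?_
    simp [Pi.single_eq_of_ne (ne_of_mem_erase hi)]

theorem mfact_ne_zero {n : ℕ} (α : Fin n → ℕ) : (mfact α : ℝ) ≠ 0 := by
  simp [mfact, prod_ne_zero_iff, Nat.factorial_ne_zero]

theorem sum_add_single {n : ℕ} (α : Fin n → ℕ) (j : Fin n) :
    ∑ i, (α + Pi.single j 1 : Fin n → ℕ) i = (∑ i, α i) + 1 := by
  simp [sum_add_distrib]

/-- Pascal-type recursion for the multinomial sums occurring in iterated directional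
derivatives. -/
theorem sum_mIdxEq_succ {n : ℕ} (m : ℕ) (v : Fin n → ℝ) (φ : (Fin n → ℕ) → ℝ) :
    ∑ α ∈ mIdxEq n m, (m.factorial / mfact α : ℝ) * mpow v α *
        ∑ j, v j * φ (α + Pi.single j 1) =
      ∑ β ∈ mIdxEq n (m + 1), ((m + 1).factorial / mfact β : ℝ) * mpow v β * φ β := by
  have key : ∀ β ∈ mIdxEq n (m + 1),
      ((m + 1).factorial / mfact β : ℝ) * mpow v β * φ β =
        ∑ j, (β j : ℝ) * ((m.factorial / mfact β : ℝ) * mpow v β * φ β) := by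
    intro β hβ
    rw [← sum_mul, ← Nat.cast_sum, mem_mIdxEq.1 hβ, Nat.factorial_succ]
    push_cast
    ring
  rw [sum_congr rfl key, sum_comm]
  simp_rw [mul_sum]
  rw [sum_comm]
  refine sum_congr rfl fun j _ => ?_
  refine sum_of_injOn (fun α => α + Pi.single j 1) (fun _ _ _ _ h => add_right_cancel h) ?_ ?_ ?_
  · intro α hα
    simp only [mem_coe, mem_mIdxEq] at hα ⊢
    rw [sum_add_single, hα]
  · intro β hβ hne
    have : β j = 0 := by
      by_contra h0
      refine hne ⟨β - Pi.single j 1, ?_, ?_⟩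
      · have hc : β - Pi.single j 1 + Pi.single j 1 = β := by
          ext i
          by_cases hi : i = j
          · subst hi
            simp
            omega
          · simp [Pi.single_eq_of_ne hi]
        have h1 := sum_add_single (β - Pi.single j 1) j
        rw [hc] at h1
        have h2 := mem_mIdxEq.1 hβ
        rw [mem_coe, mem_mIdxEq]
        omega
      · ext i
        by_cases hi : i = j
        · subst hi
          simp
          omega
        · simp [Pi.single_eq_of_ne hi]
    simp [this]
  · intro α _
    simp only [mfact_add_single, mpow_add_single]
    have h1 := mfact_ne_zero α
    have h2 : (α j : ℝ) + 1 ≠ 0 := by positivity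
    simp only [Pi.add_apply, Pi.single_eq_same]
    push_cast
    field_simp

theorem pder_eq_fderiv {n : ℕ} {g : (Fin n → ℝ) → ℝ} {y : Fin n → ℝ} (j : Fin n)
    (hg : DifferentiableAt ℝ g y) : pder j g y = fderiv ℝ g y (Pi.single j 1) := by
  have h1 := hasDerivAt_update y j (y j)
  have h2 : HasFDerivAt g (fderiv ℝ g y) (Function.update y j (y j)) := by
    rw [Function.update_eq_self]
    exact hg.hasFDerivAt
  exact (h2.comp_hasDerivAt (y j) h1).deriv

theorem hasDerivAt_comp_line {n : ℕ} {g : (Fin n → ℝ) → ℝ} {a v : Fin n → ℝ} {t : ℝ}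
    (hg : DifferentiableAt ℝ g (a + t • v)) :
    HasDerivAt (fun s : ℝ => g (a + s • v)) (∑ j, v j * pder j g (a + t • v)) t := by
  have h1 : HasDerivAt (fun s : ℝ => a + s • v) v t := by
    simpa using ((hasDerivAt_id t).smul_const v).const_add a
  have h2 := hg.hasFDerivAt.comp_hasDerivAt t h1
  refine h2.congr_deriv ?_
  generalize a + t • v = y at hg ⊢
  conv_lhs => rw [← univ_sum_single v, map_sum]
  refine sum_congr rfl fun j _ => ?_
  rw [pder_eq_fderiv j hg, show (Pi.single j (v j) : Fin n → ℝ) = v j • Pi.single j 1 by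
    rw [← Pi.single_smul]; simp, map_smul, smul_eq_mul]

theorem Set.EqOn.pder {n : ℕ} {g h : (Fin n → ℝ) → ℝ} {s : Set (Fin n → ℝ)} (hs : IsOpen s)
    (hgh : Set.EqOn g h s) (j : Fin n) : Set.EqOn (pder j g) (pder j h) s := by
  intro y hy
  refine Filter.EventuallyEq.deriv_eq ?_
  have hc : ContinuousAt (fun t : ℝ => Function.update y j t) (y j) :=
    (hasDerivAt_update y j (y j)).continuousAt
  rw [ContinuousAt, Function.update_eq_self] at hc
  filter_upwards [hc (hs.mem_nhds hy)] with t ht using hgh ht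

theorem Set.EqOn.iterate_pder {n : ℕ} {g h : (Fin n → ℝ) → ℝ} {s : Set (Fin n → ℝ)}
    (hs : IsOpen s) (hgh : Set.EqOn g h s) (j : Fin n) (p : ℕ) :
    Set.EqOn ((_root_.pder j)^[p] g) ((_root_.pder j)^[p] h) s := by
  induction p generalizing g h with
  | zero => exact hgh
  | succ p ih => exact ih (hgh.pder hs j)

/-- The restriction of `h` to the open ball extends to a `C^N` function on the closed ball. -/
def HasCkExtension {n : ℕ} (a : Fin n → ℝ) (r : ℝ) (N : ℕ) (h : (Fin n → ℝ) → ℝ) : Prop :=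
  ∃ H, ContDiffOn ℝ N H (Metric.closedBall a r) ∧ Set.EqOn h H (Metric.ball a r)

namespace HasCkExtension

variable {n : ℕ} {a : Fin n → ℝ} {r : ℝ} {h : (Fin n → ℝ) → ℝ}

theorem contDiffOn {N : ℕ} (hh : HasCkExtension a r N h) :
    ContDiffOn ℝ N h (Metric.ball a r) := by
  obtain ⟨H, hH, he⟩ := hh
  exact (hH.mono Metric.ball_subset_closedBall).congr he

theorem contDiffAt {N : ℕ} (hh : HasCkExtension a r N h) {y : Fin n → ℝ}
    (hy : y ∈ Metric.ball a r) : ContDiffAt ℝ N h y :=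
  hh.contDiffOn.contDiffAt (Metric.isOpen_ball.mem_nhds hy)

theorem differentiableAt {N : ℕ} (hh : HasCkExtension a r (N + 1) h) {y : Fin n → ℝ}
    (hy : y ∈ Metric.ball a r) : DifferentiableAt ℝ h y :=
  (hh.contDiffAt hy).differentiableAt (by simp)

theorem pder (hr : 0 < r) {N : ℕ} (hh : HasCkExtension a r (N + 1) h) (j : Fin n) :
    HasCkExtension a r N (pder j h) := by
  have hd := fun y hy => hh.differentiableAt (y := y) hy
  obtain ⟨H, hH, he⟩ := hh
  have hu : UniqueDiffOn ℝ (Metric.closedBall a r) :=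
    uniqueDiffOn_convex (convex_closedBall a r)
      ⟨a, Metric.ball_subset_interior_closedBall (Metric.mem_ball_self hr)⟩
  refine ⟨fun y => fderivWithin ℝ H (Metric.closedBall a r) y (Pi.single j 1), ?_, ?_⟩
  · exact (hH.fderivWithin hu (by norm_cast)).clm_apply contDiffOn_const
  · intro y hy
    have hn : Metric.closedBall a r ∈ nhds y :=
      Filter.mem_of_superset (Metric.isOpen_ball.mem_nhds hy) Metric.ball_subset_closedBall
    rw [pder_eq_fderiv j (hd y hy)]
    simp only
    rw [fderivWithin_of_mem_nhds hn]
    congr 1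
    exact (he.eventuallyEq_of_mem (Metric.isOpen_ball.mem_nhds hy)).fderiv_eq

theorem iterate_pder (hr : 0 < r) {N : ℕ} (p : ℕ) (hh : HasCkExtension a r (N + p) h)
    (j : Fin n) : HasCkExtension a r N ((_root_.pder j)^[p] h) := by
  induction p generalizing h with
  | zero => exact hh
  | succ p ih => exact ih (hh.pder hr j)

theorem foldr_pder (hr : 0 < r) {N : ℕ} (α : Fin n → ℕ) (L : List (Fin n))
    (hh : HasCkExtension a r (N + (L.map α).sum) h) :
    HasCkExtension a r N (L.foldr (fun j h => (_root_.pder j)^[α j] h) h) := by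
  induction L generalizing N with
  | nil => simpa using hh
  | cons i L ih =>
    refine iterate_pder hr (α i) (ih ?_) i
    simpa [add_assoc] using hh

theorem mder (hr : 0 < r) {N : ℕ} (α : Fin n → ℕ)
    (hh : HasCkExtension a r (N + ∑ j, α j) h) : HasCkExtension a r N (mder α h) := by
  refine foldr_pder hr α _ ?_
  rwa [← List.ofFn_eq_map, List.sum_ofFn]

theorem pder_comm (hh : HasCkExtension a r 2 h) (i j : Fin n) :
    Set.EqOn (_root_.pder i (_root_.pder j h)) (_root_.pder j (_root_.pder i h))
      (Metric.ball a r) := by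
  have aux : ∀ i j : Fin n, ∀ y ∈ Metric.ball a r, _root_.pder i (_root_.pder j h) y =
      fderiv ℝ (fderiv ℝ h) y (Pi.single i 1) (Pi.single j 1) := by
    intro i j y hy
    have he : Set.EqOn (_root_.pder j h) (fun z => fderiv ℝ h z (Pi.single j 1))
        (Metric.ball a r) := fun z hz => pder_eq_fderiv j (hh.differentiableAt hz)
    have hd : DifferentiableAt ℝ (fderiv ℝ h) y :=
      ((hh.contDiffAt hy).fderiv_right (m := 1) (by norm_num)).differentiableAt (by simp)
    rw [he.pder Metric.isOpen_ball i hy, pder_eq_fderiv i (by fun_prop)]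
    rw [fderiv_clm_apply hd (by fun_prop)]
    simp
  intro y hy
  rw [aux i j y hy, aux j i y hy]
  exact (hh.contDiffAt hy).isSymmSndFDerivAt (by simp) _ _

theorem pder_iterate_comm (hr : 0 < r) (p : ℕ) (hh : HasCkExtension a r (p + 1) h)
    (i j : Fin n) :
    Set.EqOn (_root_.pder j ((_root_.pder i)^[p] h)) ((_root_.pder i)^[p] (_root_.pder j h))
      (Metric.ball a r) := by
  induction p generalizing h with
  | zero => exact fun _ _ => rfl
  | succ p ih =>
    have h2 : HasCkExtension a r 2 h := by
      obtain ⟨H, hH, he⟩ := hh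
      exact ⟨H, hH.of_le (by norm_cast; omega), he⟩
    exact (ih (hh.pder hr i)).trans ((h2.pder_comm j i).iterate_pder Metric.isOpen_ball i p)

theorem pder_foldr (hr : 0 < r) (α : Fin n → ℕ) (j : Fin n) (L : List (Fin n)) (hL : L.Nodup)
    (hj : j ∈ L) (hh : HasCkExtension a r ((L.map α).sum + 1) h) :
    Set.EqOn (_root_.pder j (L.foldr (fun j h => (_root_.pder j)^[α j] h) h))
      (L.foldr (fun i h => (_root_.pder i)^[(α + Pi.single j 1 : Fin n → ℕ) i] h) h)
      (Metric.ball a r) := by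
  induction L with
  | nil => simp at hj
  | cons i L ih =>
    rw [List.nodup_cons] at hL
    simp only [List.foldr_cons]
    by_cases hij : j = i
    · subst hij
      have hc : L.foldr (fun i h => (_root_.pder i)^[(α + Pi.single j 1 : Fin n → ℕ) i] h) h =
          L.foldr (fun i h => (_root_.pder i)^[α i] h) h := by
        refine List.foldr_ext _ _ _ fun i hi g => ?_
        have : i ≠ j := fun e => hL.1 (e ▸ hi)
        simp [Pi.single_eq_of_ne this]
      rw [hc]
      simp only [Pi.add_apply, Pi.single_eq_same, Function.iterate_succ_apply']
      exact fun _ _ => rfl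
    · have hj' : j ∈ L := by simpa [hij] using hj
      have h1 : HasCkExtension a r ((L.map α).sum + 1) h := by
        obtain ⟨H, hH, he⟩ := hh
        exact ⟨H, hH.of_le (by simp only [List.map_cons, List.sum_cons]; norm_cast; omega), he⟩
      have h2 : HasCkExtension a r (α i + 1) (L.foldr (fun i h => (_root_.pder i)^[α i] h) h) := by
        refine foldr_pder hr α L ?_
        convert hh using 1
        simp
        ring
      refine (pder_iterate_comm hr (α i) h2 i j).trans ?_
      have : (α + Pi.single j 1 : Fin n → ℕ) i = α i := by simp [Pi.single_eq_of_ne (Ne.symm hij)]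
      rw [this]
      exact (ih hL.2 hj' h1).iterate_pder Metric.isOpen_ball i (α i)

theorem pder_mder (hr : 0 < r) (α : Fin n → ℕ) (j : Fin n)
    (hh : HasCkExtension a r ((∑ j, α j) + 1) h) :
    Set.EqOn (_root_.pder j (_root_.mder α h)) (_root_.mder (α + Pi.single j 1) h)
      (Metric.ball a r) := by
  refine pder_foldr hr α j _ (List.nodup_finRange n) (List.mem_finRange j) ?_
  rwa [← List.ofFn_eq_map, List.sum_ofFn]

end HasCkExtension

/-- Taylor's formula with integral remainder on `[0, 1]` for a function whose successive
derivatives in the open interval extend continuously to the closed one. -/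
theorem taylor_integral_remainder_unit_interval (k : ℕ) (G : ℕ → ℝ → ℝ)
    (hc : ∀ m ≤ k + 1, ContinuousOn (G m) (Set.Icc 0 1))
    (hd : ∀ m ≤ k, ∀ t ∈ Set.Ioo (0 : ℝ) 1, HasDerivAt (G m) (G (m + 1) t) t) :
    G 0 1 = ∑ m ∈ range (k + 1), G m 0 / (m.factorial : ℝ) +
      ∫ t in (0 : ℝ)..1, (1 - t) ^ k / (k.factorial : ℝ) * G (k + 1) t := by
  have hderiv : ∀ t ∈ Set.Ioo (0 : ℝ) 1, ∀ l ≤ k,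
      HasDerivAt (fun t => ∑ m ∈ range (l + 1), (1 - t) ^ m / (m.factorial : ℝ) * G m t)
        ((1 - t) ^ l / (l.factorial : ℝ) * G (l + 1) t) t := by
    intro t ht l
    induction l with
    | zero => intro _; simpa using hd 0 (Nat.zero_le _) t ht
    | succ l ih =>
      intro hl
      simp_rw [sum_range_succ _ (l + 1)]
      have h1 : HasDerivAt (fun t : ℝ => (1 - t) ^ (l + 1) / ((l + 1).factorial : ℝ))
          (-((1 - t) ^ l / (l.factorial : ℝ))) t := by
        have h0 := (((hasDerivAt_id t).const_sub 1).pow (l + 1)).div_const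
          ((l + 1).factorial : ℝ)
        refine h0.congr_deriv ?_
        have : (l.factorial : ℝ) ≠ 0 := by positivity
        rw [Nat.factorial_succ]
        push_cast
        simp
        field_simp
      refine ((ih (by omega)).add (h1.mul (hd (l + 1) hl t ht))).congr_deriv ?_
      ring
  have hint : IntervalIntegrable (fun t : ℝ => (1 - t) ^ k / (k.factorial : ℝ) * G (k + 1) t)
      MeasureTheory.volume 0 1 := by
    refine ContinuousOn.intervalIntegrable ?_
    rw [Set.uIcc_of_le zero_le_one]
    exact (by fun_prop : Continuous fun t : ℝ => (1 - t) ^ k / (k.factorial : ℝ)).continuousOn.mul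
      (hc _ le_rfl)
  have hcont : ContinuousOn
      (fun t => ∑ m ∈ range (k + 1), (1 - t) ^ m / (m.factorial : ℝ) * G m t)
      (Set.Icc 0 1) := by
    refine continuousOn_finsetSum _ fun m hm => ?_
    exact (by fun_prop : Continuous fun t : ℝ => (1 - t) ^ m / (m.factorial : ℝ)).continuousOn.mul
      (hc _ (by have := mem_range.1 hm; omega))
  rw [intervalIntegral.integral_eq_sub_of_hasDerivAt_of_le zero_le_one hcont
    (fun t ht => hderiv t ht k le_rfl) hint,
    sum_range_succ' (fun m => (1 - (1 : ℝ)) ^ m / (m.factorial : ℝ) * G m 1)]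
  simp [div_eq_inv_mul]

/-- **Multivariate Taylor's theorem with integral remainder.**  If `f : ℝⁿ → ℝ` is `k+1`
times continuously differentiable on a closed ball `B` centered at `a`, then for every
`x ∈ B`,
`f x = ∑_{|α| ≤ k} D^α f(a)/α! (x-a)^α + ∑_{|β| = k+1} R_β(x) (x-a)^β`, where
`R_β(x) = (|β|/β!) ∫₀¹ (1-t)^{|β|-1} D^β f(a + t(x-a)) dt`. -/
theorem multivariate_taylor_integral_remainder {n k : ℕ} (a : Fin n → ℝ) (r : ℝ)
    (hr : 0 < r) (f : (Fin n → ℝ) → ℝ)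
    (hf : ContDiffOn ℝ ((k + 1 : ℕ) : ℕ∞) f (Metric.closedBall a r))
    (x : Fin n → ℝ) (hx : x ∈ Metric.closedBall a r) :
    f x =
      (∑ α ∈ mIdxLe n k, mder α f a / (mfact α : ℝ) * mpow (x - a) α) +
        ∑ β ∈ mIdxEq n (k + 1),
          (((∑ j, β j : ℕ) : ℝ) / (mfact β : ℝ)) *
              (∫ t in (0 : ℝ)..1, (1 - t) ^ ((∑ j, β j) - 1) * mder β f (a + t • (x - a))) *
            mpow (x - a) β := by
  have hfx : HasCkExtension a r (k + 1) f := ⟨f, by exact_mod_cast hf, fun _ _ => rfl⟩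
  have hle : ∀ {N M : ℕ}, N ≤ M → HasCkExtension a r M f → HasCkExtension a r N f :=
    fun h ⟨H, hH, he⟩ => ⟨H, hH.of_le (by exact_mod_cast h), he⟩
  have hmd : ∀ (α : Fin n → ℕ) (N : ℕ), N + ∑ j, α j ≤ k + 1 →
      HasCkExtension a r N (mder α f) := fun α N h => (hle h hfx).mder hr α
  have hmder0 : mder (0 : Fin n → ℕ) f = f := by simp [mder]
  have hex : ∀ α : Fin n → ℕ, ∑ j, α j ≤ k + 1 → ∃ H : (Fin n → ℝ) → ℝ,
      ContinuousOn H (Metric.closedBall a r) ∧ Set.EqOn (mder α f) H (Metric.ball a r) ∧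
        (α = 0 → H = f) := by
    intro α hα
    by_cases h0 : α = 0
    · subst h0
      exact ⟨f, hf.continuousOn, by rw [hmder0]; exact fun _ _ => rfl, fun _ => rfl⟩
    · obtain ⟨H, hH, he⟩ := hmd α 0 (by simpa using hα)
      exact ⟨H, hH.continuousOn, he, fun h => absurd h h0⟩
  choose! H hHc hHe hH0 using hex
  set v := x - a with hv
  have hvr : ‖v‖ ≤ r := by simpa [hv, dist_eq_norm] using hx
  have hcl : ∀ t ∈ Set.Icc (0 : ℝ) 1, a + t • v ∈ Metric.closedBall a r := by
    intro t ht
    rw [Metric.mem_closedBall, dist_eq_norm, add_sub_cancel_left, norm_smul, Real.norm_eq_abs,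
      abs_of_nonneg ht.1]
    nlinarith [ht.1, ht.2, norm_nonneg v]
  have hop : ∀ t ∈ Set.Ico (0 : ℝ) 1, a + t • v ∈ Metric.ball a r := by
    intro t ht
    rw [Metric.mem_ball, dist_eq_norm, add_sub_cancel_left, norm_smul, Real.norm_eq_abs,
      abs_of_nonneg ht.1]
    nlinarith [ht.1, ht.2, norm_nonneg v]
  have hline : ∀ α : Fin n → ℕ, ∑ j, α j ≤ k + 1 →
      ContinuousOn (fun t : ℝ => H α (a + t • v)) (Set.Icc 0 1) := fun α hα =>
    (hHc α hα).comp (by fun_prop : Continuous fun t : ℝ => a + t • v).continuousOn hcl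
  have hmain := taylor_integral_remainder_unit_interval k
    (fun m t => ∑ α ∈ mIdxEq n m, (m.factorial / mfact α : ℝ) * mpow v α * H α (a + t • v))
    (fun m hm => continuousOn_finsetSum _ fun α hα =>
      continuousOn_const.mul (hline α ((mem_mIdxEq.1 hα).trans_le hm))) ?_
  · have hz : mIdxEq n 0 = {0} := by
      ext α
      rw [mem_mIdxEq, mem_singleton]
      simp [funext_iff]
    have hleft : ∑ α ∈ mIdxEq n 0, ((Nat.factorial 0 : ℕ) / mfact α : ℝ) * mpow v α *
        H α (a + (1 : ℝ) • v) = f x := by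
      rw [hz, sum_singleton, hH0 0 (by simp) rfl]
      simp [mfact, mpow, hv]
    rw [← hleft, hmain, sum_mIdxLe]
    congr 1
    · refine sum_congr rfl fun m hm => ?_
      rw [sum_div]
      refine sum_congr rfl fun α hα => ?_
      have h1 : ∑ j, α j ≤ k + 1 := by
        have := mem_mIdxEq.1 hα
        have := mem_range.1 hm
        omega
      rw [zero_smul, add_zero, ← hHe α h1 (Metric.mem_ball_self hr)]
      have : (m.factorial : ℝ) ≠ 0 := by positivity
      field_simp
    · simp_rw [mul_sum]
      rw [intervalIntegral.integral_finsetSum]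
      · refine sum_congr rfl fun β hβ => ?_
        rw [mem_mIdxEq.1 hβ, add_tsub_cancel_right]
        rw [intervalIntegral.integral_congr_Ioo_of_le zero_le_one
          (g := fun t => ((k + 1 : ℕ) / mfact β * mpow v β : ℝ) *
            ((1 - t) ^ k * mder β f (a + t • v)))]
        · rw [intervalIntegral.integral_const_mul]
          ring
        · intro t ht
          simp only
          rw [hHe β (mem_mIdxEq.1 hβ).le (hop t ⟨ht.1.le, ht.2⟩), Nat.factorial_succ]
          have : (k.factorial : ℝ) ≠ 0 := by positivity
          push_cast
          field_simp
      · intro β hβ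
        refine ContinuousOn.intervalIntegrable ?_
        rw [Set.uIcc_of_le zero_le_one]
        exact (by fun_prop : Continuous fun t : ℝ =>
          (1 - t) ^ k / (k.factorial : ℝ)).continuousOn.mul
            (continuousOn_const.mul (hline β (mem_mIdxEq.1 hβ).le))
  · intro m hm t ht
    have htb := hop t ⟨ht.1.le, ht.2⟩
    have hnear : ∀ᶠ s in nhds t, a + s • v ∈ Metric.ball a r := by
      filter_upwards [Ioo_mem_nhds ht.1 ht.2] with s hs using hop s ⟨hs.1.le, hs.2⟩
    have hD : HasDerivAt (fun s => ∑ α ∈ mIdxEq n m,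
        (m.factorial / mfact α : ℝ) * mpow v α * mder α f (a + s • v))
        (∑ α ∈ mIdxEq n m, (m.factorial / mfact α : ℝ) * mpow v α *
          ∑ j, v j * pder j (mder α f) (a + t • v)) t := by
      refine HasDerivAt.fun_sum fun α hα => ?_
      refine (hasDerivAt_comp_line ?_).const_mul _
      refine (hmd α (0 + 1) ?_).differentiableAt htb
      have := mem_mIdxEq.1 hα
      omega
    refine (hD.congr_deriv ?_).congr_of_eventuallyEq ?_
    · rw [← sum_mIdxEq_succ m v fun β => H β (a + t • v)]
      refine sum_congr rfl fun α hα => ?_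
      congr 1
      refine sum_congr rfl fun j _ => ?_
      have h1 : (∑ i, α i) + 1 ≤ k + 1 := by
        have := mem_mIdxEq.1 hα
        omega
      rw [HasCkExtension.pder_mder hr α j (hle h1 hfx) htb,
        hHe _ (by rw [sum_add_single]; exact h1) htb]
    · filter_upwards [hnear] with s hs
      refine sum_congr rfl fun α hα => ?_
      rw [hHe α (by have := mem_mIdxEq.1 hα; omega) hs]
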